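/- Let A > 0, 0 < a ≤ 1/A, T > 0, and let v(x) = √(1/A² − x²) − √(1/A² − a²). Let u be continuous on [−a,a] × [0,T), with u_x, u_xx, u_t continuous on (−a,a) × (0,T), solving the graph flow equation u_t = u_xx/(1 + u_x²) + A√(1 + u_x²) on (−a,a) × (0,T), with u(−a,t) = u(a,t) = 0 for all t ∈ [0,T) and u(x,0) ≤ v(x) for all x ∈ [−a,a]. Then u(x,t) ≤ v(x) for all x ∈ [−a,a] and t ∈ [0,T); and if moreover u(·,0) is not identically equal to v, then u(x,t) < v(x) for every x ∈ (−a,a) and t ∈ (0,T). -/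

import Mathlib

open Set

lemma second_deriv_nonpos_of_localMax {f f' : ℝ → ℝ} {q x : ℝ}
    (hf : ∀ᶠ y in nhds x, HasDerivAt f (f' y) y) (hf' : HasDerivAt f' q x)
    (hm : IsLocalMax f x) : q ≤ 0 := by
  by_contra hq
  push Not at hq
  have hd : deriv f =ᶠ[nhds x] f' := hf.mono fun y hy => hy.deriv
  have hdd : deriv (deriv f) x = q := by rw [hd.deriv_eq, hf'.deriv]
  have hmin : IsLocalMin f x := isLocalMin_of_deriv_deriv_pos (by rw [hdd]; exact hq)
    hm.deriv_eq_zero hf.self_of_nhds.continuousAt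
  have hc : f =ᶠ[nhds x] fun _ => f x := by
    filter_upwards [hm, hmin] with y h1 h2 using le_antisymm h1 h2
  have h3 : deriv f =ᶠ[nhds x] deriv (fun _ => f x) := hc.deriv
  have h4 : deriv (deriv f) x = 0 := by
    rw [h3.deriv_eq]; simp
  linarith

lemma deriv_nonneg_of_left_max {h : ℝ → ℝ} {h' t : ℝ} (hh : HasDerivAt h h' t)
    (hm : ∀ᶠ τ in nhdsWithin t (Iio t), h τ ≤ h t) : 0 ≤ h' := by
  have h1 := (hasDerivAt_iff_tendsto_slope.1 hh).mono_left
    (nhdsWithin_mono t (show Iio t ⊆ {t}ᶜ from fun y hy => ne_of_lt hy))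
  refine ge_of_tendsto h1 ?_
  filter_upwards [hm, self_mem_nhdsWithin] with τ h2 h3
  rw [slope_def_field]
  exact div_nonneg_of_nonpos (by linarith) (by have : τ < t := h3; linarith)

lemma touch_ineq {A x t q zt p uxx ut : ℝ} {u z : ℝ → ℝ → ℝ} {ux zx : ℝ → ℝ}
    (hux : ∀ᶠ y in nhds x, HasDerivAt (fun y => u y t) (ux y) y)
    (huxx : HasDerivAt ux uxx x)
    (hut : HasDerivAt (fun τ => u x τ) ut t)
    (hpde : ut = uxx / (1 + ux x ^ 2) + A * Real.sqrt (1 + ux x ^ 2))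
    (hzx : ∀ᶠ y in nhds x, HasDerivAt (fun y => z y t) (zx y) y)
    (hzxx : HasDerivAt zx q x) (hp : zx x = p)
    (hzt : HasDerivAt (fun τ => z x τ) zt t)
    (hmx : ∀ᶠ y in nhds x, u y t - z y t ≤ u x t - z x t)
    (hmt : ∀ᶠ τ in nhdsWithin t (Iio t), u x τ - z x τ ≤ u x t - z x t) :
    zt ≤ q / (1 + p ^ 2) + A * Real.sqrt (1 + p ^ 2) := by
  have hd : ∀ᶠ y in nhds x, HasDerivAt (fun y => u y t - z y t) (ux y - zx y) y := by
    filter_upwards [hux, hzx] with y h1 h2 using h1.sub h2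
  have h2 := second_deriv_nonpos_of_localMax hd (huxx.sub hzxx) hmx
  have h1 : ux x - zx x = 0 := IsLocalMax.hasDerivAt_eq_zero hmx hd.self_of_nhds
  have h3 := deriv_nonneg_of_left_max (hut.sub hzt) hmt
  have h4 : ux x = p := by linarith
  rw [h4] at hpde
  have : uxx / (1 + p ^ 2) ≤ q / (1 + p ^ 2) := by gcongr; linarith
  linarith

lemma flow_lip (A p r q b : ℝ) (hA : 0 ≤ A)
    (h0 : q / (1 + p ^ 2) + A * Real.sqrt (1 + p ^ 2) = 0) :
    (q - b) / (1 + r ^ 2) + A * Real.sqrt (1 + r ^ 2) ≤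
      - b / (1 + r ^ 2) + (|q| + A) * |r - p| := by
  have e1 : |q / (1 + r ^ 2) - q / (1 + p ^ 2)| ≤ |q| * |r - p| := by
    have : q / (1 + r ^ 2) - q / (1 + p ^ 2)
        = q * ((p - r) * ((p + r) / ((1 + r ^ 2) * (1 + p ^ 2)))) := by
      field_simp; ring
    rw [this, abs_mul, abs_mul]
    have h5 : |(p + r) / ((1 + r ^ 2) * (1 + p ^ 2))| ≤ 1 := by
      rw [abs_div, abs_of_pos (show (0:ℝ) < (1 + r ^ 2) * (1 + p ^ 2) by positivity),
        div_le_one (by positivity), abs_le]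
      constructor <;> nlinarith [sq_nonneg (p + 1), sq_nonneg (p - 1), sq_nonneg (r + 1),
        sq_nonneg (r - 1), sq_nonneg (p * r)]
    rw [abs_sub_comm r p]
    gcongr
    exact mul_le_of_le_one_right (abs_nonneg _) h5
  have e2 : Real.sqrt (1 + r ^ 2) - Real.sqrt (1 + p ^ 2) ≤ |r - p| := by
    have : Real.sqrt (1 + r ^ 2) ≤ Real.sqrt (1 + p ^ 2) + |r - p| := by
      rw [Real.sqrt_le_left (by positivity)]
      have hs := Real.sq_sqrt (show (0:ℝ) ≤ 1 + p ^ 2 by positivity)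
      have hp : |p| ≤ Real.sqrt (1 + p ^ 2) := Real.abs_le_sqrt (by linarith)
      have h6 : p * (r - p) ≤ |p| * |r - p| := by rw [← abs_mul]; exact le_abs_self _
      have h7 := sq_abs (r - p)
      have h8 := mul_le_mul_of_nonneg_right hp (abs_nonneg (r - p))
      nlinarith
    linarith
  have e3 := mul_le_mul_of_nonneg_left e2 hA
  have e4 := (abs_le.1 e1).2
  have : (q - b) / (1 + r ^ 2) = q / (1 + r ^ 2) + - b / (1 + r ^ 2) := by ring
  rw [this]
  nlinarith

lemma arc_derivs {A x c : ℝ} (hA : 0 < A) (hx : x ^ 2 < 1 / A ^ 2) :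
    HasDerivAt (fun y => Real.sqrt (1 / A ^ 2 - y ^ 2) - c)
      (- x / Real.sqrt (1 / A ^ 2 - x ^ 2)) x ∧
    HasDerivAt (fun y => - y / Real.sqrt (1 / A ^ 2 - y ^ 2))
      (- (1 / A ^ 2) / Real.sqrt (1 / A ^ 2 - x ^ 2) ^ 3) x ∧
    (- (1 / A ^ 2) / Real.sqrt (1 / A ^ 2 - x ^ 2) ^ 3) /
      (1 + (- x / Real.sqrt (1 / A ^ 2 - x ^ 2)) ^ 2) +
      A * Real.sqrt (1 + (- x / Real.sqrt (1 / A ^ 2 - x ^ 2)) ^ 2) = 0 := by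
  have hpos : 0 < 1 / A ^ 2 - x ^ 2 := by linarith
  have hs := Real.sqrt_pos.2 hpos
  have hsq := Real.sq_sqrt hpos.le
  have hd : HasDerivAt (fun y => Real.sqrt (1 / A ^ 2 - y ^ 2))
      (- x / Real.sqrt (1 / A ^ 2 - x ^ 2)) x := by
    have h1 : HasDerivAt (fun y : ℝ => 1 / A ^ 2 - y ^ 2) (- (2 * x)) x := by
      have h0 := (hasDerivAt_pow 2 x).const_sub (1 / A ^ 2)
      refine h0.congr_deriv ?_
      norm_num
    convert h1.sqrt hpos.ne' using 1
    field_simp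
  refine ⟨hd.sub_const c, ?_, ?_⟩
  · refine ((hasDerivAt_neg x).div hd hs.ne').congr_deriv ?_
    generalize Real.sqrt (1 / A ^ 2 - x ^ 2) = s at *
    have : 1 / A ^ 2 = s ^ 2 + x ^ 2 := by linarith
    rw [this]
    simp
    field_simp
    ring
  · generalize Real.sqrt (1 / A ^ 2 - x ^ 2) = s at *
    have h1 : 1 + (- x / s) ^ 2 = (1 / (A * s)) ^ 2 := by
      have : 1 / A ^ 2 = s ^ 2 + x ^ 2 := by linarith
      have h2 : (1 / (A * s)) ^ 2 = (1 / A ^ 2) / s ^ 2 := by field_simp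
      rw [h2, this]; field_simp
    rw [h1, Real.sqrt_sq (by positivity)]
    field_simp
    ring

lemma barrier_alg {m0 m rho C s y g k : ℝ} (hm0 : 0 < m0) (hm : m0 ≤ m) (hm1 : m ≤ 1)
    (hrho : 0 < rho) (hC : 0 ≤ C) (hg : 0 < g) (hgy : g = rho ^ 2 - y ^ 2)
    (hk : k = (12 + 4 * (C + |s|) * rho) ^ 2 / (16 * m0 * rho ^ 2)) :
    - k * g ^ 2 + 4 * s * y * g < m * (8 * y ^ 2 - 4 * g) - C * (4 * |y| * g) := by
  have hy : |y| ≤ rho := abs_le_of_sq_le_sq (by linarith) hrho.le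
  have h1 : s * y * g ≤ |s| * rho * g := by
    have : s * y ≤ |s| * |y| := by rw [← abs_mul]; exact le_abs_self _
    have h2 := mul_le_mul_of_nonneg_left hy (abs_nonneg s)
    nlinarith
  have h3 : C * |y| * g ≤ C * rho * g := by gcongr
  have h4 : m0 * y ^ 2 ≤ m * y ^ 2 := by gcongr
  have h5 : m * g ≤ g := by nlinarith
  have h5' : m0 * g ≤ g := by nlinarith
  set B := 12 + 4 * (C + |s|) * rho with hB
  have h6 : 0 < k * g ^ 2 - B * g + 8 * m0 * rho ^ 2 := by
    have e : k * g ^ 2 - B * g + 8 * m0 * rho ^ 2 =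
        ((B * g - 8 * m0 * rho ^ 2) ^ 2 + 64 * m0 ^ 2 * rho ^ 4) / (16 * m0 * rho ^ 2) := by
      rw [hk]; field_simp; ring
    rw [e]; positivity
  have h7 : m0 * y ^ 2 = m0 * rho ^ 2 - m0 * g := by rw [hgy]; ring
  have h8 : B * g = 12 * g + 4 * (C * rho * g) + 4 * (|s| * rho * g) := by rw [hB]; ring
  nlinarith

set_option maxHeartbeats 4000000

/-- Comparison with the lower equilibrium arc: if `u` solves the graph
flow `u_t = u_xx/(1+u_x²) + A√(1+u_x²)` on `(-a,a)×(0,T)` with zero boundary values on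
`x = ±a` and `u(·,0) ≤ v`, then `u ≤ v` everywhere; and if `u(·,0)` is not identically
`v`, the inequality is strict in the interior. -/
theorem comparison_with_equilibrium (A a T : ℝ) (hA : 0 < A) (ha : 0 < a)
    (haA : a ≤ 1 / A) (hT : 0 < T)
    (v : ℝ → ℝ)
    (hv : ∀ x : ℝ, v x = Real.sqrt (1 / A ^ 2 - x ^ 2) - Real.sqrt (1 / A ^ 2 - a ^ 2))
    (u ux uxx ut : ℝ → ℝ → ℝ)
    (hu_cont : ContinuousOn (fun p : ℝ × ℝ => u p.1 p.2) (Icc (-a) a ×ˢ Ico 0 T))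
    (hux : ∀ x ∈ Ioo (-a) a, ∀ t ∈ Ioo (0 : ℝ) T,
      HasDerivAt (fun y => u y t) (ux x t) x)
    (huxx : ∀ x ∈ Ioo (-a) a, ∀ t ∈ Ioo (0 : ℝ) T,
      HasDerivAt (fun y => ux y t) (uxx x t) x)
    (hut : ∀ x ∈ Ioo (-a) a, ∀ t ∈ Ioo (0 : ℝ) T,
      HasDerivAt (fun τ => u x τ) (ut x t) t)
    (hux_cont : ContinuousOn (fun p : ℝ × ℝ => ux p.1 p.2) (Ioo (-a) a ×ˢ Ioo 0 T))
    (huxx_cont : ContinuousOn (fun p : ℝ × ℝ => uxx p.1 p.2) (Ioo (-a) a ×ˢ Ioo 0 T))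
    (hut_cont : ContinuousOn (fun p : ℝ × ℝ => ut p.1 p.2) (Ioo (-a) a ×ˢ Ioo 0 T))
    (hpde : ∀ x ∈ Ioo (-a) a, ∀ t ∈ Ioo (0 : ℝ) T,
      ut x t = uxx x t / (1 + (ux x t) ^ 2) + A * Real.sqrt (1 + (ux x t) ^ 2))
    (hbc : ∀ t ∈ Ico (0 : ℝ) T, u (-a) t = 0 ∧ u a t = 0)
    (hic : ∀ x ∈ Icc (-a) a, u x 0 ≤ v x) :
    (∀ x ∈ Icc (-a) a, ∀ t ∈ Ico (0 : ℝ) T, u x t ≤ v x) ∧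
    ((¬ ∀ x ∈ Icc (-a) a, u x 0 = v x) →
      ∀ x ∈ Ioo (-a) a, ∀ t ∈ Ioo (0 : ℝ) T, u x t < v x) := by
  have hsq : ∀ x ∈ Ioo (-a) a, x ^ 2 < 1 / A ^ 2 := by
    intro x hx
    have h1 : x ^ 2 < a ^ 2 := sq_lt_sq' hx.1 hx.2
    have h2 : a ^ 2 ≤ (1 / A) ^ 2 := by gcongr
    rw [one_div_pow] at h2
    linarith
  have hvfun : v = fun y => Real.sqrt (1 / A ^ 2 - y ^ 2) - Real.sqrt (1 / A ^ 2 - a ^ 2) :=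
    funext hv
  have hva : v a = 0 := by rw [hv]; ring
  have hvna : v (-a) = 0 := by rw [hv]; simp
  have hvcont : Continuous v := by rw [hvfun]; fun_prop
  obtain ⟨vp, hvp⟩ : ∃ vp : ℝ → ℝ, vp = fun y => - y / Real.sqrt (1 / A ^ 2 - y ^ 2) := ⟨_, rfl⟩
  obtain ⟨vq, hvq⟩ : ∃ vq : ℝ → ℝ,
    vq = fun y => - (1 / A ^ 2) / Real.sqrt (1 / A ^ 2 - y ^ 2) ^ 3 := ⟨_, rfl⟩
  have hv1 : ∀ x ∈ Ioo (-a) a, HasDerivAt v (vp x) x := by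
    intro x hx
    rw [hvfun, hvp]
    exact (arc_derivs hA (hsq x hx)).1
  have hv2 : ∀ x ∈ Ioo (-a) a, HasDerivAt vp (vq x) x := by
    intro x hx
    rw [hvp, hvq]
    exact (arc_derivs (c := 0) hA (hsq x hx)).2.1
  have hv0 : ∀ x ∈ Ioo (-a) a,
      vq x / (1 + vp x ^ 2) + A * Real.sqrt (1 + vp x ^ 2) = 0 := by
    intro x hx
    rw [hvp, hvq]
    exact (arc_derivs (c := 0) hA (hsq x hx)).2.2
  have hvqc : ContinuousOn vq (Ioo (-a) a) := by
    rw [hvq]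
    refine ContinuousOn.div (by fun_prop) (by fun_prop) ?_
    intro x hx
    have := Real.sqrt_pos.2 (sub_pos.2 (hsq x hx))
    positivity
  have hnh : ∀ x ∈ Ioo (-a) a, ∀ᶠ y in nhds x, y ∈ Ioo (-a) a := fun x hx =>
    isOpen_Ioo.mem_nhds hx
  -- weak comparison
  have weak : ∀ x ∈ Icc (-a) a, ∀ t ∈ Ico (0 : ℝ) T, u x t ≤ v x := by
    intro x0 hx0 t0 ht0
    by_contra hcon
    push Not at hcon
    obtain ⟨e, he, he2⟩ : ∃ e : ℝ, 0 < e ∧ 0 < u x0 t0 - v x0 - e * t0 := by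
      have h1 : 0 < t0 + 1 := by linarith [ht0.1]
      refine ⟨(u x0 t0 - v x0) / (t0 + 1), div_pos (by linarith) h1, ?_⟩
      have : u x0 t0 - v x0 - (u x0 t0 - v x0) / (t0 + 1) * t0
        = (u x0 t0 - v x0) / (t0 + 1) := by field_simp; ring
      rw [this]; exact div_pos (by linarith) h1
    have hsub : Icc (-a) a ×ˢ Icc 0 t0 ⊆ Icc (-a) a ×ˢ Ico 0 T :=
      prod_mono Subset.rfl (fun s hs => ⟨hs.1, hs.2.trans_lt ht0.2⟩)
    have hfc : ContinuousOn (fun p : ℝ × ℝ => u p.1 p.2 - (v p.1 + e * p.2))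
        (Icc (-a) a ×ˢ Icc 0 t0) :=
      (hu_cont.mono hsub).sub (by fun_prop)
    have hmem : ((x0, t0) : ℝ × ℝ) ∈ Icc (-a) a ×ˢ Icc 0 t0 := ⟨hx0, ht0.1, le_refl _⟩
    obtain ⟨⟨x, t⟩, hxt, hmax⟩ := (isCompact_Icc.prod isCompact_Icc).exists_isMaxOn ⟨_, hmem⟩ hfc
    have hmax' : ∀ y ∈ Icc (-a) a, ∀ τ ∈ Icc 0 t0,
        u y τ - (v y + e * τ) ≤ u x t - (v x + e * t) := fun y hy τ hτ =>
      hmax (show ((y, τ) : ℝ × ℝ) ∈ _ from ⟨hy, hτ⟩)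
    have hpos : 0 < u x t - (v x + e * t) := by
      have := hmax' x0 hx0 t0 ⟨ht0.1, le_refl _⟩
      linarith
    obtain ⟨hx, ht⟩ := hxt
    simp only at hx ht
    have htT : t < T := ht.2.trans_lt ht0.2
    have het : 0 ≤ e * t := mul_nonneg he.le ht.1
    have hx' : x ∈ Ioo (-a) a := by
      refine ⟨lt_of_le_of_ne hx.1 ?_, lt_of_le_of_ne hx.2 ?_⟩
      · rintro rfl
        have := (hbc t ⟨ht.1, htT⟩).1
        linarith
      · rintro rfl
        have := (hbc t ⟨ht.1, htT⟩).2
        linarith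
    have ht' : 0 < t := by
      refine lt_of_le_of_ne ht.1 ?_
      rintro rfl
      have := hic x hx
      linarith
    have key := touch_ineq (A := A) (u := u) (z := fun y τ => v y + e * τ) (x := x) (t := t)
      (q := vq x) (p := vp x) (zt := e)
      (ux := fun y => ux y t) (zx := vp)
      ((hnh x hx').mono fun y hy => hux y hy t ⟨ht', htT⟩)
      (huxx x hx' t ⟨ht', htT⟩) (hut x hx' t ⟨ht', htT⟩) (hpde x hx' t ⟨ht', htT⟩)
      ((hnh x hx').mono fun y hy => (hv1 y hy).add_const _)
      (hv2 x hx') rfl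
      (by simpa using ((hasDerivAt_id t).const_mul e).const_add (v x))
      ((hnh x hx').mono fun y hy => hmax' y (Ioo_subset_Icc_self hy) t ht)
      (by
        filter_upwards [Ioo_mem_nhdsLT ht'] with τ hτ
        exact hmax' x hx τ ⟨hτ.1.le, hτ.2.le.trans ht.2⟩)
    rw [hv0 x hx'] at key
    linarith
  refine ⟨weak, ?_⟩
  intro hne x1 hx1 t1 ht1
  push Not at hne
  obtain ⟨x0, hx0, hne0⟩ := hne
  have h0T : (0 : ℝ) ∈ Ico 0 T := ⟨le_refl _, hT⟩
  have hx0' : x0 ∈ Ioo (-a) a := by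
    refine ⟨lt_of_le_of_ne hx0.1 ?_, lt_of_le_of_ne hx0.2 ?_⟩
    · rintro rfl
      exact hne0 (by rw [(hbc 0 h0T).1, hvna])
    · rintro rfl
      exact hne0 (by rw [(hbc 0 h0T).2, hva])
  have hlt0 : u x0 0 < v x0 := lt_of_le_of_ne (hic x0 hx0) hne0
  have hu0 : ContinuousOn (fun y => u y 0) (Icc (-a) a) :=
    hu_cont.comp (f := fun y : ℝ => ((y, 0) : ℝ × ℝ)) (by fun_prop) (fun y hy => ⟨hy, h0T⟩)
  have hev : ∀ᶠ y in nhds x0, u y 0 < v y :=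
    (hu0.continuousAt (Icc_mem_nhds hx0'.1 hx0'.2)).eventually_lt hvcont.continuousAt hlt0
  obtain ⟨r, hr, hball⟩ := Metric.eventually_nhds_iff.1 hev
  have hab0 : |x0| < a := abs_lt.2 hx0'
  have hab1 : |x1| < a := abs_lt.2 hx1
  obtain ⟨c, hc1, hca⟩ := exists_between (max_lt hab0 hab1)
  obtain ⟨rho, hrho, hrho2⟩ := exists_between (lt_min hr (sub_pos.2 hc1))
  have hrr : rho < r := hrho2.trans_le (min_le_left _ _)
  have hrc : rho < c - max |x0| |x1| := hrho2.trans_le (min_le_right _ _)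
  have hsubc : Icc (-c) c ⊆ Ioo (-a) a := fun y hy => ⟨by linarith [hy.1], by linarith [hy.2]⟩
  have hvpc : ContinuousOn vp (Icc (-c) c) := fun y hy =>
    (hv2 y (hsubc hy)).continuousAt.continuousWithinAt
  obtain ⟨P, hP⟩ := isCompact_Icc.exists_bound_of_continuousOn hvpc
  obtain ⟨Q, hQ⟩ := isCompact_Icc.exists_bound_of_continuousOn (hvqc.mono hsubc)
  simp only [Real.norm_eq_abs] at hP hQ
  obtain ⟨s, hs⟩ : ∃ s, s = (x1 - x0) / t1 := ⟨_, rfl⟩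
  have hst1 : x0 + s * t1 = x1 := by
    have := ht1.1.ne'
    rw [hs]; field_simp; ring
  have hxi : ∀ τ ∈ Icc 0 t1, |x0 + s * τ| ≤ max |x0| |x1| := by
    intro τ hτ
    have h1 : x0 + s * τ = (1 - τ / t1) * x0 + (τ / t1) * x1 := by
      have := ht1.1.ne'
      rw [hs]; field_simp; ring
    have h2 : 0 ≤ τ / t1 := div_nonneg hτ.1 ht1.1.le
    have h3 : τ / t1 ≤ 1 := (div_le_one ht1.1).2 hτ.2
    rw [h1]
    calc _ ≤ |(1 - τ / t1) * x0| + |(τ / t1) * x1| := abs_add_le _ _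
      _ = (1 - τ / t1) * |x0| + (τ / t1) * |x1| := by
        rw [abs_mul, abs_mul, abs_of_nonneg h2, abs_of_nonneg (sub_nonneg.2 h3)]
      _ ≤ (1 - τ / t1) * max |x0| |x1| + (τ / t1) * max |x0| |x1| := by
        have := sub_nonneg.2 h3
        gcongr
        · exact le_max_left _ _
        · exact le_max_right _ _
      _ = _ := by ring
  have hKc : ∀ y, ∀ τ ∈ Icc 0 t1, |y - (x0 + s * τ)| ≤ rho → y ∈ Icc (-c) c := by
    intro y τ hτ hy
    have h1 := hxi τ hτ
    have h2 : |y| ≤ |y - (x0 + s * τ)| + |x0 + s * τ| := by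
      simpa using abs_add_le (y - (x0 + s * τ)) (x0 + s * τ)
    exact abs_le.1 (by linarith)
  -- initial gap
  have h0t1 : (0 : ℝ) ∈ Icc 0 t1 := ⟨le_refl _, ht1.1.le⟩
  obtain ⟨mu, hmu, hgap⟩ : ∃ mu > 0, ∀ y, |y - x0| ≤ rho → u y 0 + mu ≤ v y := by
    have hss : Icc (x0 - rho) (x0 + rho) ⊆ Icc (-a) a := fun y hy =>
      Ioo_subset_Icc_self (hsubc (hKc y 0 h0t1 (by
        rw [abs_le]; constructor <;> linarith [hy.1, hy.2])))
    have hcc : ContinuousOn (fun y => v y - u y 0) (Icc (x0 - rho) (x0 + rho)) :=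
      hvcont.continuousOn.sub (hu0.mono hss)
    obtain ⟨y0, hy0, hmin⟩ := isCompact_Icc.exists_isMinOn
      ⟨x0, by constructor <;> linarith⟩ hcc
    refine ⟨v y0 - u y0 0, ?_, ?_⟩
    · have : u y0 0 < v y0 := hball (by
        rw [Real.dist_eq, abs_lt]; constructor <;> linarith [hy0.1, hy0.2])
      linarith
    · intro y hy
      have hy' := abs_le.1 hy
      have : v y0 - u y0 0 ≤ v y - u y 0 :=
        hmin (show y ∈ Icc (x0 - rho) (x0 + rho) from
          ⟨by linarith [hy'.1], by linarith [hy'.2]⟩)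
      linarith
  obtain ⟨d, hd, hd2⟩ := exists_between
    (lt_min (one_pos) (div_pos hmu (show 0 < rho ^ 4 by positivity)))
  have hd1 : d < 1 := hd2.trans_le (min_le_left _ _)
  have hdmu : d * rho ^ 4 < mu := (lt_div_iff₀ (by positivity)).1 (hd2.trans_le (min_le_right _ _))
  obtain ⟨m0, hm0⟩ : ∃ m0, m0 = 1 / (1 + (P + 4 * rho ^ 3) ^ 2) := ⟨_, rfl⟩
  have hm0pos : 0 < m0 := by rw [hm0]; positivity
  have hQ0 : 0 ≤ Q := (abs_nonneg _).trans (hQ x0 (hKc x0 0 h0t1 (by simpa using hrho.le)))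
  have hP0 : 0 ≤ P := (abs_nonneg _).trans (hP x0 (hKc x0 0 h0t1 (by simpa using hrho.le)))
  obtain ⟨k, hk⟩ : ∃ k, k = (12 + 4 * ((Q + A) + |s|) * rho) ^ 2 / (16 * m0 * rho ^ 2) :=
    ⟨_, rfl⟩
  have hk0 : 0 ≤ k := by rw [hk]; positivity
  obtain ⟨z, hz⟩ : ∃ z : ℝ → ℝ → ℝ, z = fun y τ =>
    v y - d * (Real.exp (-k * τ) * (rho ^ 2 - (y - (x0 + s * τ)) ^ 2) ^ 2) := ⟨_, rfl⟩
  obtain ⟨K, hK⟩ : ∃ K : Set (ℝ × ℝ), K =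
    (Icc (-c) c ×ˢ Icc 0 t1) ∩ {p | |p.1 - (x0 + s * p.2)| ≤ rho} := ⟨_, rfl⟩
  have hKcomp : IsCompact K := by
    rw [hK]
    exact (isCompact_Icc.prod isCompact_Icc).inter_right
      (isClosed_le (by fun_prop) (by fun_prop))
  have hKmem : ∀ y, ∀ τ ∈ Icc 0 t1, |y - (x0 + s * τ)| ≤ rho → (y, τ) ∈ K := by
    intro y τ hτ hy
    rw [hK]
    exact ⟨⟨hKc y τ hτ hy, hτ⟩, hy⟩
  have hfc : ContinuousOn (fun p : ℝ × ℝ => u p.1 p.2 - z p.1 p.2) K := by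
    refine (hu_cont.mono ?_).sub ?_
    · rw [hK]
      rintro ⟨y, τ⟩ ⟨⟨h1, h2⟩, -⟩
      exact ⟨Ioo_subset_Icc_self (hsubc h1), h2.1, h2.2.trans_lt ht1.2⟩
    · rw [hz]; fun_prop
  have hmem1 : (x1, t1) ∈ K := hKmem x1 t1 ⟨ht1.1.le, le_refl _⟩ (by
    rw [hst1]; simpa using hrho.le)
  obtain ⟨⟨x, t⟩, hxt, hmax⟩ := hKcomp.exists_isMaxOn ⟨_, hmem1⟩ hfc
  have hmax' : ∀ y, ∀ τ ∈ Icc 0 t1, |y - (x0 + s * τ)| ≤ rho →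
      u y τ - z y τ ≤ u x t - z x t := fun y τ hτ hy => hmax (hKmem y τ hτ hy)
  have hle : u x t - z x t ≤ 0 := by
    by_contra hpos
    push Not at hpos
    rw [hK] at hxt
    obtain ⟨⟨hx, ht⟩, hy⟩ := hxt
    simp only [mem_ofPred_eq] at hx ht hy
    have hxI := hsubc hx
    have htT : t < T := ht.2.trans_lt ht1.2
    have hw := weak x (Ioo_subset_Icc_self hxI) t ⟨ht.1, htT⟩
    have ht' : 0 < t := by
      refine lt_of_le_of_ne ht.1 ?_
      rintro rfl
      have hy' : |x - x0| ≤ rho := by simpa using hy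
      have h1 := hgap x hy'
      have h2 : (x - x0) ^ 2 ≤ rho ^ 2 := sq_le_sq' (abs_le.1 hy').1 (abs_le.1 hy').2
      have h3 : (rho ^ 2 - (x - x0) ^ 2) ^ 2 ≤ rho ^ 4 := by
        nlinarith [sq_nonneg (x - x0)]
      have h4 := mul_le_mul_of_nonneg_left h3 hd.le
      rw [hz] at hpos
      simp at hpos
      linarith
    have hylt : |x - (x0 + s * t)| < rho := by
      refine lt_of_le_of_ne hy ?_
      intro h
      have : (x - (x0 + s * t)) ^ 2 = rho ^ 2 := by rw [← h, sq_abs]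
      rw [hz] at hpos
      simp only [this] at hpos
      simp at hpos
      linarith
    obtain ⟨y, hydef⟩ : ∃ y, y = x - (x0 + s * t) := ⟨_, rfl⟩
    obtain ⟨g, hg⟩ : ∃ g, g = rho ^ 2 - y ^ 2 := ⟨_, rfl⟩
    obtain ⟨E, hE⟩ : ∃ E, E = Real.exp (-k * t) := ⟨_, rfl⟩
    have hE0 : 0 < E := by rw [hE]; exact Real.exp_pos _
    have hE1 : E ≤ 1 := by
      rw [hE, Real.exp_le_one_iff, neg_mul]; exact neg_nonpos.2 (mul_nonneg hk0 ht.1)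
    rw [← hydef] at hylt
    have hg0 : 0 < g := by
      have := sq_lt_sq' (abs_lt.1 hylt).1 (abs_lt.1 hylt).2
      linarith
    have hgr : g ≤ rho ^ 2 := by rw [hg]; linarith [sq_nonneg y]
    have htI : t ∈ Ioo 0 T := ⟨ht', htT⟩
    have key := touch_ineq (A := A) (u := u) (z := z) (x := x) (t := t)
      (q := vq x - d * (E * (8 * y ^ 2 - 4 * g))) (p := vp x - d * (E * (-4 * y * g)))
      (zt := - (d * (E * (-k * g ^ 2 + 4 * s * y * g))))
      (ux := fun y => ux y t)
      (zx := fun w => vp w - d * (E * (-4 * (w - (x0 + s * t)) *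
        (rho ^ 2 - (w - (x0 + s * t)) ^ 2))))
      ((hnh x hxI).mono fun y hy => hux y hy t htI)
      (huxx x hxI t htI) (hut x hxI t htI) (hpde x hxI t htI)
      (by
        refine (hnh x hxI).mono fun w hw => ?_
        rw [hz, hE]
        have h1 : HasDerivAt (fun w : ℝ => w - (x0 + s * t)) 1 w :=
          (hasDerivAt_id w).sub_const _
        refine ((hv1 w hw).sub ((((h1.pow 2).const_sub (rho ^ 2)).pow 2
          |>.const_mul (Real.exp (-k * t))).const_mul d)).congr_deriv ?_
        simp
        ring_nf
        simp)
      (by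
        have h1 : HasDerivAt (fun w : ℝ => w - (x0 + s * t)) 1 x :=
          (hasDerivAt_id x).sub_const _
        refine ((hv2 x hxI).sub ((((h1.const_mul (-4)).mul
          ((h1.pow 2).const_sub (rho ^ 2))).const_mul E).const_mul d)).congr_deriv ?_
        simp only [Pi.pow_apply]
        rw [← hydef, hg]
        simp
        ring_nf
        simp)
      (by simp only [← hydef, ← hg])
      (by
        have h1 : HasDerivAt (fun τ : ℝ => x - (x0 + s * τ)) (-s) t := by
          simpa using (((hasDerivAt_id t).const_mul s).const_add x0).const_sub x
        have h2 : HasDerivAt (fun τ : ℝ => Real.exp (-k * τ)) (E * (-k)) t := by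
          rw [hE]
          simpa using ((hasDerivAt_id t).const_mul (-k)).exp
        rw [hz]
        refine ((((h2.mul (((h1.pow 2).const_sub (rho ^ 2)).pow 2))).const_mul d).const_sub
          (v x)).congr_deriv ?_
        simp only [Pi.pow_apply]
        rw [← hydef, ← hg, ← hE]
        simp
        ring_nf
        simp)
      (by
        have : ∀ᶠ w in nhds x, |w - (x0 + s * t)| < rho :=
          (show ContinuousAt (fun w : ℝ => |w - (x0 + s * t)|) x by fun_prop).eventually_lt
            continuousAt_const (by rw [← hydef]; exact hylt)
        filter_upwards [this] with w hw
        exact hmax' w t ht hw.le)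
      (by
        have : ∀ᶠ τ in nhds t, |x - (x0 + s * τ)| < rho :=
          (show ContinuousAt (fun τ : ℝ => |x - (x0 + s * τ)|) t by fun_prop).eventually_lt
            continuousAt_const (by rw [← hydef]; exact hylt)
        filter_upwards [nhdsWithin_le_nhds this, Ioo_mem_nhdsLT ht'] with τ hτ1 hτ
        exact hmax' x τ ⟨hτ.1.le, hτ.2.le.trans ht.2⟩ hτ1.le)
    obtain ⟨p, hp⟩ : ∃ p, p = vp x - d * (E * (-4 * y * g)) := ⟨_, rfl⟩
    have hlip := flow_lip A (vp x) p (vq x) (d * (E * (8 * y ^ 2 - 4 * g))) hA.le (hv0 x hxI)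
    rw [← hp] at key
    have hpd : |p - vp x| = d * E * (4 * |y| * g) := by
      have : p - vp x = d * E * (4 * y * g) := by rw [hp]; ring
      rw [this, abs_mul, abs_mul, abs_mul, abs_mul, abs_of_pos hd, abs_of_pos hE0,
        abs_of_pos hg0]
      norm_num
    have hpb : |p| ≤ P + 4 * rho ^ 3 := by
      have h1 : |p| ≤ |p - vp x| + |vp x| := by simpa using abs_add_le (p - vp x) (vp x)
      have h2 := hP x hx
      have h3 : d * E * (4 * |y| * g) ≤ 1 * 1 * (4 * rho * rho ^ 2) := by gcongr
      rw [hpd] at h1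
      linarith
    have hmm : m0 ≤ 1 / (1 + p ^ 2) := by
      rw [hm0]
      have : p ^ 2 ≤ (P + 4 * rho ^ 3) ^ 2 := by
        rw [← sq_abs p]; gcongr
      gcongr
    have hm1 : 1 / (1 + p ^ 2) ≤ 1 := by
      rw [div_le_one (by positivity)]; nlinarith [sq_nonneg p]
    have halg := barrier_alg (s := s) hm0pos hmm hm1 hrho (C := Q + A) (by linarith) hg0 hg hk
    have hdE : 0 < d * E := mul_pos hd hE0
    have halg' := mul_lt_mul_of_pos_left halg hdE
    have hQ' := hQ x hx
    rw [hpd] at hlip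
    have hnn : 0 ≤ d * E * (4 * |y| * g) := by positivity
    have h9 : (|vq x| + A) * (d * E * (4 * |y| * g)) ≤ (Q + A) * (d * E * (4 * |y| * g)) := by
      gcongr
    have h10 : -(d * (E * (8 * y ^ 2 - 4 * g))) / (1 + p ^ 2) =
      - (d * E * (1 / (1 + p ^ 2) * (8 * y ^ 2 - 4 * g))) := by ring
    rw [h10] at hlip
    have h11 : d * E * (1 / (1 + p ^ 2) * (8 * y ^ 2 - 4 * g) - (Q + A) * (4 * |y| * g)) =
      d * E * (1 / (1 + p ^ 2) * (8 * y ^ 2 - 4 * g)) - (Q + A) * (d * E * (4 * |y| * g)) := by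
      ring
    rw [h11] at halg'
    linarith
  have hfin := (hmax' x1 t1 ⟨ht1.1.le, le_refl _⟩ (by
    rw [hst1]; simpa using hrho.le)).trans hle
  rw [hz] at hfin
  simp only [hst1] at hfin
  have : 0 < d * (Real.exp (-k * t1) * (rho ^ 2 - (x1 - x1) ^ 2) ^ 2) := by
    rw [sub_self]
    have := Real.exp_pos (-k * t1)
    have h2 : 0 < rho ^ 2 - 0 ^ 2 := by simp; positivity
    positivity
  linarith
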